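/- For each vertex i ∈ V and each ρ ∈ Rec(i), the probability P_{s_0}{ i_τ = i and R_i(s_τ) = ρ } converges to α_i/κ as |s_0| → −∞. -/

import Mathlib

open scoped BigOperators
open Classical Filter

noncomputable section

namespace ThresholdState

variable {V : Type*} [Fintype V] [DecidableEq V]

/-- `A i j` is the number of directed edges from `i` to `j`. -/
def outdeg (A : V → V → ℕ) (i : V) : ℕ := ∑ j, A i j

def indeg (A : V → V → ℕ) (i : V) : ℕ := ∑ j, A j i

/-- Eulerian: out-degree equals in-degree at every vertex. -/
def Eulerian (A : V → V → ℕ) : Prop := ∀ i, outdeg A i = indeg A i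

/-- (Strongly) connected multigraph. -/
def Connected (A : V → V → ℕ) : Prop :=
  ∀ i j : V, Relation.ReflTransGen (fun a b => 0 < A a b) i j

def deg (A : V → V → ℕ) (i : V) : ℕ := outdeg A i

/-- Graph Laplacian: `Δu(i) = -deg(i)·u(i) + Σ_{e incoming to i} u(e⁻)`. -/
def lap (A : V → V → ℕ) (u : V → ℤ) (i : V) : ℤ :=
  -(deg A i : ℤ) * u i + ∑ j, (A j i : ℤ) * u j

def delta (z : V) : V → ℤ := fun j => if j = z then 1 else 0

/-- Toppling vertex `i`: replace `s` by `s + Δδ_i`. -/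
def toppleAt (A : V → V → ℕ) (s : V → ℤ) (i : V) : V → ℤ :=
  fun j => s j + lap A (delta i) j

def applySeq (A : V → V → ℕ) (s : V → ℤ) (l : List V) : V → ℤ :=
  l.foldl (toppleAt A) s

/-- A legal toppling sequence (avoiding the forbidden set `F`): each toppled
vertex is unstable when toppled and does not lie in `F`. -/
def ValidSeq (A : V → V → ℕ) (F : V → Prop) : (V → ℤ) → List V → Prop
  | _, [] => True
  | s, i :: l => ¬ F i ∧ (deg A i : ℤ) ≤ s i ∧ ValidSeq A F (toppleAt A s i) l

/-- Stable at every non-forbidden vertex. -/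
def StableOff (A : V → V → ℕ) (F : V → Prop) (s : V → ℤ) : Prop :=
  ∀ i, ¬ F i → s i ≤ (deg A i : ℤ) - 1

def StabilizesTo (A : V → V → ℕ) (F : V → Prop) (s : V → ℤ) (l : List V) : Prop :=
  ValidSeq A F s l ∧ StableOff A F (applySeq A s l)

def StabilizableVia (A : V → V → ℕ) (F : V → Prop) (s : V → ℤ) : Prop :=
  ∃ l, StabilizesTo A F s l

/-- Stabilizable with no forbidden vertices. -/
def Stabilizable (A : V → V → ℕ) (s : V → ℤ) : Prop :=
  StabilizableVia A (fun _ => False) s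

def stabSeq (A : V → V → ℕ) (F : V → Prop) (s : V → ℤ) : List V :=
  if h : StabilizableVia A F s then h.choose else []

def stabilizeVia (A : V → V → ℕ) (F : V → Prop) (s : V → ℤ) : V → ℤ :=
  applySeq A s (stabSeq A F s)

/-- Odometer: number of topplings at each vertex (`0` everywhere if not stabilizable). -/
def odometerVia (A : V → V → ℕ) (F : V → Prop) (s : V → ℤ) : V → ℕ :=
  fun i => (stabSeq A F s).count i

def sinkStabilize (A : V → V → ℕ) (z : V) (s : V → ℤ) : V → ℤ :=
  stabilizeVia A (fun i => i = z) s

def sinkOdometer (A : V → V → ℕ) (z : V) (s : V → ℤ) : V → ℕ :=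
  odometerVia A (fun i => i = z) s

/-- `ρ` is `z`-recurrent (Dhar's burning test): `ρ(z) = deg z`, `ρ(i) ≤ deg i - 1`
off the sink, and every site other than `z` topples exactly once in the
stabilization of `ρ + Δδ_z` with sink `z`. -/
def ZRec (A : V → V → ℕ) (z : V) (ρ : V → ℤ) : Prop :=
  ρ z = (deg A z : ℤ) ∧ (∀ i, i ≠ z → ρ i ≤ (deg A i : ℤ) - 1) ∧
  ∃ l : List V, StabilizesTo A (fun i => i = z) (fun j => ρ j + lap A (delta z) j) l ∧
    ∀ i, i ≠ z → l.count i = 1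

/-- `κ` = number of `z`-recurrent sandpiles. -/
def kappa (A : V → V → ℕ) (z : V) : ℕ := Nat.card {ρ : V → ℤ // ZRec A z ρ}

def totalMass (s : V → ℤ) : ℤ := ∑ i, s i

/-- Open addition operator `â_i` (with sink `z`). -/
def openAdd (A : V → V → ℕ) (z i : V) (ρ : V → ℤ) : V → ℤ :=
  fun j => if j = z then (deg A z : ℤ) else sinkStabilize A z (fun k => ρ k + delta i k) j

/-- `â_i⁻¹` on `Rec(z)`. -/
def openAddInv (A : V → V → ℕ) (z i : V) (ρ : V → ℤ) : V → ℤ :=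
  if h : ∃ ρ', ZRec A z ρ' ∧ openAdd A z i ρ' = ρ then h.choose else ρ

/-- Burst size `av_{i→z}(ρ) = |â_i⁻¹ρ| - |ρ| + 1`. -/
def burst (A : V → V → ℕ) (z i : V) (ρ : V → ℤ) : ℤ :=
  totalMass (openAddInv A z i ρ) - totalMass ρ + 1

/-- The `z`-recurrent decomposition `s = ρ + m·δ_z + Δv` with `ρ ∈ Rec(z)`, `v(z)=0`. -/
def ZDecomp (A : V → V → ℕ) (z : V) (s ρ : V → ℤ) (m : ℤ) (v : V → ℤ) : Prop :=
  ZRec A z ρ ∧ v z = 0 ∧ ∀ j, s j = ρ j + m * delta z j + lap A v j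

/-- `R_z(s)`: the `z`-recurrent representative of `s`. -/
def Rz (A : V → V → ℕ) (z : V) (s : V → ℤ) : V → ℤ :=
  if h : ∃ ρ, ∃ m, ∃ v, ZDecomp A z s ρ m v then h.choose else s

/-- `m_z(s)`: the integer in the `z`-recurrent decomposition of `s`. -/
def mz (A : V → V → ℕ) (z : V) (s : V → ℤ) : ℤ :=
  if h : ∃ m, ∃ ρ, ∃ v, ZDecomp A z s ρ m v then h.choose else 0

/-- Closed addition operator `a_i`. -/
def closedAdd (A : V → V → ℕ) (i : V) (s : V → ℤ) : V → ℤ :=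
  if Stabilizable A (fun j => s j + delta i j) then
    stabilizeVia A (fun _ => False) (fun j => s j + delta i j)
  else fun j => s j + delta i j

/-- The closed chain after making the additions listed in `w` (in order). -/
def chain (A : V → V → ℕ) (s0 : V → ℤ) (w : List V) : V → ℤ :=
  w.foldl (fun s i => closedAdd A i s) s0

/-- `w` is a threshold word for `s0`: the chain first becomes non-stabilizable
exactly after the additions in `w`, i.e. `τ = |w|` on the cylinder of `w`. -/
def IsThresholdWord (A : V → V → ℕ) (s0 : V → ℤ) (w : List V) : Prop :=
  ¬ Stabilizable A (chain A s0 w) ∧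
  ∀ w' : List V, w' <+: w → w' ≠ w → Stabilizable A (chain A s0 w')

def wordProb (α : V → ℝ) (w : List V) : ℝ := (w.map α).prod

/-- `P_{s0}(E at the threshold time)`: total probability of the (disjoint)
cylinders of threshold words satisfying `E`. -/
def thresholdProb (A : V → V → ℕ) (α : V → ℝ) (s0 : V → ℤ) (E : List V → Prop) : ℝ :=
  ∑' w : List V, if IsThresholdWord A s0 w ∧ E w then wordProb α w else 0

/-- `E_{s0}[f at the threshold time]`. -/
def thresholdExp (A : V → V → ℕ) (α : V → ℝ) (s0 : V → ℤ) (f : List V → ℝ) : ℝ :=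
  ∑' w : List V, if IsThresholdWord A s0 w then wordProb α w * f w else 0

set_option linter.unusedSectionVars false

section Laplacian

/-- The Laplacian as a homomorphism of additive groups. -/
def lapHom (A : V → V → ℕ) : (V → ℤ) →+ (V → ℤ) where
  toFun := lap A
  map_zero' := by ext j; simp [lap]
  map_add' u v := by
    ext j
    simp only [lap, Pi.add_apply, mul_add, Finset.sum_add_distrib]
    ring

theorem lapHom_apply (A : V → V → ℕ) (u : V → ℤ) : lapHom A u = lap A u := rfl

theorem lap_add (A : V → V → ℕ) (u v : V → ℤ) : lap A (u + v) = lap A u + lap A v :=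
  map_add (lapHom A) u v

theorem lap_sub (A : V → V → ℕ) (u v : V → ℤ) : lap A (u - v) = lap A u - lap A v :=
  map_sub (lapHom A) u v

theorem lap_neg (A : V → V → ℕ) (u : V → ℤ) : lap A (-u) = -lap A u :=
  map_neg (lapHom A) u

theorem lap_zero (A : V → V → ℕ) : lap A 0 = 0 := map_zero (lapHom A)

theorem lap_zsmul (A : V → V → ℕ) (n : ℤ) (u : V → ℤ) : lap A (n • u) = n • lap A u :=
  map_zsmul (lapHom A) n u

theorem Eulerian.deg_eq {A : V → V → ℕ} (hA : Eulerian A) (j : V) :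
    (deg A j : ℤ) = ∑ k, (A k j : ℤ) := by
  rw [deg, hA j, indeg]; push_cast; rfl

theorem Eulerian.lap_eq_sum_sub {A : V → V → ℕ} (hA : Eulerian A) (u : V → ℤ) (j : V) :
    lap A u j = ∑ k, (A k j : ℤ) * (u k - u j) := by
  simp only [lap, hA.deg_eq, mul_sub, Finset.sum_sub_distrib, Finset.sum_mul, neg_mul]
  ring

theorem Eulerian.lap_const {A : V → V → ℕ} (hA : Eulerian A) (c : ℤ) :
    lap A (fun _ => c) = 0 := by
  ext j; simp [hA.lap_eq_sum_sub]

theorem Eulerian.lap_sub_const {A : V → V → ℕ} (hA : Eulerian A) (u : V → ℤ) (c : ℤ) :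
    lap A (fun k => u k - c) = lap A u := by
  have := lap_sub A u (fun _ => c)
  rw [hA.lap_const, sub_zero] at this
  exact this

theorem totalMass_add (s t : V → ℤ) : totalMass (s + t) = totalMass s + totalMass t := by
  simp [totalMass, Finset.sum_add_distrib]

theorem totalMass_lap (A : V → V → ℕ) (u : V → ℤ) : totalMass (lap A u) = 0 := by
  simp only [totalMass, lap, Finset.sum_add_distrib]
  rw [Finset.sum_comm (f := fun i j => (A j i : ℤ) * u j), ← Finset.sum_add_distrib]
  refine Finset.sum_eq_zero fun j _ => ?_
  rw [← Finset.sum_mul, deg, outdeg]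
  push_cast
  ring

theorem totalMass_delta (z : V) : totalMass (delta z) = 1 := by
  simp [totalMass, delta]

theorem totalMass_zsmul (n : ℤ) (s : V → ℤ) : totalMass (n • s) = n * totalMass s := by
  simp [totalMass, Finset.mul_sum]

end Laplacian

section Toppling

theorem count_cons_eq (i : V) (l : List V) :
    (fun j => ((i :: l).count j : ℤ)) = delta i + fun j => (l.count j : ℤ) := by
  ext j
  by_cases h : j = i
  · subst h; simp [delta]; ring
  · simp [delta, h, Ne.symm h]

theorem applySeq_eq (A : V → V → ℕ) (s : V → ℤ) (l : List V) :
    applySeq A s l = s + lap A (fun j => (l.count j : ℤ)) := by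
  induction l generalizing s with
  | nil =>
    have : (fun j : V => (([] : List V).count j : ℤ)) = 0 := by ext; simp
    rw [this, lap_zero]; simp [applySeq]
  | cons i l ih =>
    have h : applySeq A s (i :: l) = applySeq A (s + lap A (delta i)) l := rfl
    rw [h, ih, count_cons_eq, lap_add, add_assoc]

theorem lap_nonneg_of_eq_zero (A : V → V → ℕ) {u : V → ℤ} (hu : 0 ≤ u) {j : V} (hj : u j = 0) :
    0 ≤ lap A u j := by
  rw [lap, hj, mul_zero, zero_add]
  exact Finset.sum_nonneg fun k _ => mul_nonneg (by positivity) (hu k)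

/-- The least action principle, in the form: a sandpile that can be stabilized by some
nonnegative toppling vector, legal or not, is stabilizable. -/
theorem stabilizable_of_nonneg (A : V → V → ℕ) (n : ℕ) (s u : V → ℤ) (hu : 0 ≤ u)
    (hn : ∑ j, u j = n) (hs : ∀ j, s j + lap A u j ≤ (deg A j : ℤ) - 1) : Stabilizable A s := by
  induction n generalizing s u with
  | zero =>
    have hu0 : u = 0 := by
      ext j
      exact (Finset.sum_eq_zero_iff_of_nonneg fun k _ => hu k).1 (by simpa using hn) j
        (Finset.mem_univ j)
    subst hu0
    refine ⟨[], trivial, fun j _ => ?_⟩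
    simpa [lap_zero, applySeq] using hs j
  | succ n ih =>
    by_cases hst : ∀ j, s j ≤ (deg A j : ℤ) - 1
    · exact ⟨[], trivial, fun j _ => hst j⟩
    · push Not at hst
      obtain ⟨i, hi⟩ := hst
      have hui : 1 ≤ u i := by
        by_contra! h
        have h0 : u i = 0 := le_antisymm (by omega) (hu i)
        have := lap_nonneg_of_eq_zero A hu h0
        have := hs i
        omega
      obtain ⟨l, hl, hl'⟩ := ih (toppleAt A s i) (u - delta i)
        (fun j => by
          by_cases h : j = i
          · subst h; simpa [delta] using hui
          · simpa [delta, h] using hu j)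
        (by
          have := totalMass_delta i
          simp only [totalMass] at this
          simp only [Pi.sub_apply, Finset.sum_sub_distrib, hn, this]
          push_cast; ring)
        (fun j => by
          have := hs j
          simp only [toppleAt, lap_sub, Pi.sub_apply]
          linarith)
      exact ⟨i :: l, ⟨not_false, by omega, hl⟩, hl'⟩

theorem Eulerian.stabilizable_iff {A : V → V → ℕ} (hA : Eulerian A) (s : V → ℤ) :
    Stabilizable A s ↔ ∃ u : V → ℤ, ∀ j, s j + lap A u j ≤ (deg A j : ℤ) - 1 := by
  constructor
  · rintro ⟨l, -, hl⟩
    refine ⟨fun k => (l.count k : ℤ), fun j => ?_⟩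
    have := hl j not_false
    rw [applySeq_eq] at this
    exact this
  · rintro ⟨u, hu⟩
    have hnn : (0 : V → ℤ) ≤ fun k => u k - -(∑ j, |u j|) := fun k => by
      have h1 : |u k| ≤ ∑ j, |u j| :=
        Finset.single_le_sum (f := fun j => |u j|) (fun j _ => abs_nonneg _) (Finset.mem_univ k)
      have h2 := neg_abs_le (u k)
      simp only [Pi.zero_apply]
      linarith
    obtain ⟨n, hn⟩ := Int.eq_ofNat_of_zero_le (Finset.sum_nonneg fun k _ => hnn k)
    refine stabilizable_of_nonneg A n s _ hnn hn ?_
    rw [hA.lap_sub_const]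
    exact hu

theorem Eulerian.stabilizable_add_lap {A : V → V → ℕ} (hA : Eulerian A) (s u : V → ℤ) :
    Stabilizable A (s + lap A u) ↔ Stabilizable A s := by
  rw [hA.stabilizable_iff, hA.stabilizable_iff]
  constructor
  · rintro ⟨v, hv⟩
    refine ⟨u + v, fun j => ?_⟩
    have := hv j
    simp only [lap_add, Pi.add_apply] at this ⊢
    linarith
  · rintro ⟨v, hv⟩
    refine ⟨v - u, fun j => ?_⟩
    have := hv j
    simp only [lap_sub, Pi.add_apply, Pi.sub_apply] at this ⊢
    linarith

theorem Eulerian.stabilizable_mono {A : V → V → ℕ} (hA : Eulerian A) {s t : V → ℤ} (hst : s ≤ t)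
    (ht : Stabilizable A t) : Stabilizable A s := by
  rw [hA.stabilizable_iff] at *
  obtain ⟨u, hu⟩ := ht
  exact ⟨u, fun j => by linarith [hu j, hst j]⟩

end Toppling

section Burning

theorem ValidSeq.exists_first {A : V → V → ℕ} {F : V → Prop} {s : V → ℤ} {l : List V}
    (hl : ValidSeq A F s l) {T : Finset V} (hT : ∃ j ∈ T, j ∈ l) :
    ∃ j ∈ T, ∃ l', l'.Sublist l ∧ (∀ k ∈ l', k ∉ T ∧ ¬ F k) ∧
      (deg A j : ℤ) ≤ applySeq A s l' j := by
  induction l generalizing s with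
  | nil => simp at hT
  | cons i l ih =>
    by_cases hi : i ∈ T
    · exact ⟨i, hi, [], by simp, by simp, hl.2.1⟩
    · obtain ⟨j, hjT, hj⟩ := hT
      have hjl : j ∈ l := by
        rcases List.mem_cons.1 hj with h | h
        · exact absurd (h ▸ hjT) hi
        · exact h
      obtain ⟨j', hj', l', hsub, hl', hdeg⟩ := ih hl.2.2 ⟨j, hjT, hjl⟩
      refine ⟨j', hj', i :: l', hsub.cons_cons i, ?_, hdeg⟩
      intro k hk
      rcases List.mem_cons.1 hk with h | h
      · subst h; exact ⟨hi, hl.1⟩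
      · exact hl' k h

theorem lap_indicator_compl (A : V → V → ℕ) {T : Finset V} {j : V} (hj : j ∈ T) :
    lap A (fun k => if k ∈ T then 0 else 1) j = ∑ k ∈ Tᶜ, (A k j : ℤ) := by
  simp [lap, hj, Finset.sum_ite, Finset.compl_eq_univ_sdiff, Finset.filter_notMem_eq_sdiff]

/-- A recurrent sandpile has no forbidden subconfigurations. -/
theorem ZRec.exists_burnable {A : V → V → ℕ} {z : V} {ρ : V → ℤ} (hρ : ZRec A z ρ)
    {T : Finset V} (hT : T.Nonempty) (hz : z ∉ T) :
    ∃ j ∈ T, (deg A j : ℤ) ≤ ρ j + ∑ k ∈ Tᶜ, (A k j : ℤ) := by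
  obtain ⟨-, -, l, ⟨hl, -⟩, hcount⟩ := hρ
  obtain ⟨j₀, hj₀⟩ := hT
  have hj₀z : j₀ ≠ z := fun h => hz (h ▸ hj₀)
  obtain ⟨j, hj, l', hsub, hl', hdeg⟩ := hl.exists_first
    ⟨j₀, hj₀, List.count_pos_iff.1 (by rw [hcount j₀ hj₀z]; exact one_pos)⟩
  refine ⟨j, hj, hdeg.trans ?_⟩
  rw [applySeq_eq, ← lap_indicator_compl A hj]
  set c : V → ℤ := delta z + fun k => (l'.count k : ℤ) with hc
  have hlc : lap A (delta z) j + lap A (fun k => (l'.count k : ℤ)) j = lap A c j := by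
    rw [hc, lap_add]; rfl
  have hcT : ∀ k, c k ≤ if k ∈ T then 0 else 1 := by
    intro k
    by_cases hkz : k = z
    · subst hkz
      have : k ∉ l' := fun h => (hl' k h).2 rfl
      simp [hc, delta, hz, List.count_eq_zero_of_not_mem this]
    · by_cases hk : k ∈ T
      · have : k ∉ l' := fun h => (hl' k h).1 hk
        simp [hc, delta, hkz, hk, List.count_eq_zero_of_not_mem this]
      · have := hsub.count_le k
        rw [hcount k hkz] at this
        simpa [hc, delta, hkz, hk] using this
  have hcj : c j = 0 := by
    have hjz : j ≠ z := fun h => hz (h ▸ hj)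
    have : j ∉ l' := fun h => (hl' j h).1 hj
    simp [hc, delta, hjz, List.count_eq_zero_of_not_mem this]
  have : lap A c j ≤ lap A (fun k => if k ∈ T then 0 else 1) j := by
    simp only [lap, hcj, hj, if_true]
    gcongr with k
    exact hcT k
  simp only [Pi.add_apply]
  linarith

/-- If toppling by `v` keeps a recurrent sandpile stable off the sink, then `v` attains its
minimum at the sink. -/
theorem ZRec.le_of_stableOff {A : V → V → ℕ} (hA : Eulerian A) {z : V} {ρ : V → ℤ}
    (hρ : ZRec A z ρ) {v : V → ℤ} (hv : ∀ j, j ≠ z → ρ j + lap A v j ≤ (deg A j : ℤ) - 1)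
    (k : V) : v z ≤ v k := by
  have : Nonempty V := ⟨z⟩
  obtain ⟨x, hx⟩ := Finite.exists_min v
  refine le_trans ?_ (hx k)
  by_contra! hlt
  let T : Finset V := Finset.univ.filter fun j => v j = v x
  have hzT : z ∉ T := by simp [T, hlt.ne']
  obtain ⟨j, hj, hdeg⟩ := hρ.exists_burnable (T := T) ⟨x, by simp [T]⟩ hzT
  have hjx : v j = v x := by simpa [T] using hj
  have hjz : j ≠ z := fun h => hzT (h ▸ hj)
  have h1 : ∑ k ∈ Tᶜ, (A k j : ℤ) ≤ lap A v j := by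
    rw [hA.lap_eq_sum_sub, ← Finset.sum_add_sum_compl T]
    have h2 : 0 ≤ ∑ k ∈ T, (A k j : ℤ) * (v k - v j) :=
      Finset.sum_nonneg fun k _ => mul_nonneg (by positivity) (by rw [hjx]; linarith [hx k])
    have h3 : ∑ k ∈ Tᶜ, (A k j : ℤ) ≤ ∑ k ∈ Tᶜ, (A k j : ℤ) * (v k - v j) := by
      refine Finset.sum_le_sum fun k hk => ?_
      have hk' : v k ≠ v x := by simpa [T] using hk
      have : 1 ≤ v k - v j := by
        have := lt_of_le_of_ne (hx k) hk'.symm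
        omega
      exact le_mul_of_one_le_right (by positivity) this
    linarith
  have := hv j hjz
  linarith

theorem ZRec.not_stabilizable {A : V → V → ℕ} (hA : Eulerian A) {z : V} {ρ : V → ℤ}
    (hρ : ZRec A z ρ) : ¬ Stabilizable A ρ := by
  rw [hA.stabilizable_iff]
  rintro ⟨u, hu⟩
  have hmin := hρ.le_of_stableOff hA (v := u) fun j _ => hu j
  have h := hu z
  have : 0 ≤ lap A u z := by
    rw [hA.lap_eq_sum_sub]
    exact Finset.sum_nonneg fun k _ => mul_nonneg (by positivity) (by linarith [hmin k])
  rw [hρ.1] at h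
  linarith

theorem ZRec.stabilizable_add_zsmul_iff {A : V → V → ℕ} (hA : Eulerian A) {z : V} {ρ : V → ℤ}
    (hρ : ZRec A z ρ) (m : ℤ) : Stabilizable A (ρ + m • delta z) ↔ m < 0 := by
  constructor
  · intro h
    by_contra! hm
    refine hρ.not_stabilizable hA (hA.stabilizable_mono (fun j => ?_) h)
    by_cases hj : j = z <;> simp [delta, hj, hm]
  · intro hm
    refine ⟨[], trivial, fun j _ => ?_⟩
    by_cases hj : j = z
    · subst hj
      simp only [applySeq, List.foldl_nil, Pi.add_apply, Pi.smul_apply, delta, if_true, hρ.1,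
        smul_eq_mul, mul_one]
      omega
    · simpa [applySeq, delta, hj] using hρ.2.1 j hj

theorem ZRec.unique {A : V → V → ℕ} (hA : Eulerian A) {z : V} {ρ ρ' : V → ℤ}
    (hρ : ZRec A z ρ) (hρ' : ZRec A z ρ') {m : ℤ} {v : V → ℤ}
    (h : ρ' = ρ + m • delta z + lap A v) : ρ' = ρ := by
  have h1 := hρ.le_of_stableOff hA (v := v) fun j hj => by
    have := hρ'.2.1 j hj
    simpa [h, delta, hj] using this
  have h2 := hρ'.le_of_stableOff hA (v := -v) fun j hj => by
    have := hρ.2.1 j hj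
    simpa [h, delta, hj, lap_neg] using this
  have hv : v = fun _ => v z := by
    ext k
    have h2k := h2 k
    simp only [Pi.neg_apply] at h2k
    exact le_antisymm (by linarith) (h1 k)
  ext j
  by_cases hj : j = z
  · rw [hj, hρ.1, hρ'.1]
  · rw [h, hv, hA.lap_const]
    simp [delta, hj]

theorem ZRec.nonneg {A : V → V → ℕ} (hA : Eulerian A) {z : V} {ρ : V → ℤ}
    (hρ : ZRec A z ρ) : 0 ≤ ρ := by
  intro j
  by_cases hj : j = z
  · rw [hj, hρ.1]; simp
  · obtain ⟨k, hk, hdeg⟩ := hρ.exists_burnable (T := {j}) (by simp) (by simpa using Ne.symm hj)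
    obtain rfl : k = j := by simpa using hk
    have h1 : ∑ x ∈ ({k} : Finset V)ᶜ, (A x k : ℤ) ≤ deg A k := by
      rw [hA.deg_eq]
      exact Finset.sum_le_univ_sum_of_nonneg fun x => by positivity
    simp only [Pi.zero_apply]
    linarith

theorem finite_zRec {A : V → V → ℕ} (hA : Eulerian A) (z : V) :
    Finite {ρ : V → ℤ // ZRec A z ρ} := by
  refine Set.Finite.subset (Set.finite_Icc (0 : V → ℤ) fun j => (deg A j : ℤ)) ?_
  intro ρ hρ
  refine ⟨ZRec.nonneg hA hρ, fun j => ?_⟩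
  by_cases hj : j = z
  · exact (hj ▸ hρ.1).le
  · exact (hρ.2.1 j hj).trans (by simp)

theorem exists_validSeq_of_burnable {A : V → V → ℕ} {z : V} {ρ : V → ℤ}
    (h : ∀ T : Finset V, T.Nonempty → z ∉ T →
      ∃ j ∈ T, (deg A j : ℤ) ≤ ρ j + ∑ k ∈ Tᶜ, (A k j : ℤ))
    (n : ℕ) (T : Finset V) (hn : T.card = n) (hz : z ∉ T) :
    ∃ l : List V, ValidSeq A (fun i => i = z) (ρ + lap A fun k => if k ∈ T then 0 else 1) l ∧
      ∀ j, l.count j = if j ∈ T then 1 else 0 := by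
  induction n generalizing T with
  | zero =>
    rw [Finset.card_eq_zero] at hn
    subst hn
    exact ⟨[], trivial, by simp⟩
  | succ n ih =>
    obtain ⟨j, hj, hdeg⟩ := h T (Finset.card_pos.1 (by omega)) hz
    obtain ⟨l, hl, hcount⟩ := ih (T.erase j) (by rw [Finset.card_erase_of_mem hj, hn]; rfl)
      (fun hmem => hz (Finset.mem_of_mem_erase hmem))
    have htop : toppleAt A (ρ + lap A fun k => if k ∈ T then 0 else 1) j =
        ρ + lap A fun k => if k ∈ T.erase j then 0 else 1 := by
      have hsum : (fun k => if k ∈ T.erase j then (0 : ℤ) else 1) =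
          (fun k => if k ∈ T then 0 else 1) + delta j := by
        ext k
        by_cases hk : k = j
        · subst hk; simp [delta, hj]
        · simp [delta, hk]
      rw [hsum, lap_add, ← add_assoc]
      rfl
    refine ⟨j :: l, ⟨fun e => hz (e ▸ hj), ?_, htop ▸ hl⟩, fun k => ?_⟩
    · rw [Pi.add_apply, lap_indicator_compl A hj]
      exact hdeg
    · by_cases hk : k = j
      · subst hk; simp [hcount, hj]
      · simp [hcount, hk, Ne.symm hk]

theorem zRec_of_burnable {A : V → V → ℕ} (hA : Eulerian A) {z : V} {ρ : V → ℤ}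
    (hz : ρ z = deg A z) (hst : ∀ j, j ≠ z → ρ j ≤ (deg A j : ℤ) - 1)
    (h : ∀ T : Finset V, T.Nonempty → z ∉ T →
      ∃ j ∈ T, (deg A j : ℤ) ≤ ρ j + ∑ k ∈ Tᶜ, (A k j : ℤ)) : ZRec A z ρ := by
  obtain ⟨l, hl, hcount⟩ := exists_validSeq_of_burnable h _ (Finset.univ.erase z) rfl (by simp)
  have hδ : (fun k => if k ∈ Finset.univ.erase z then (0 : ℤ) else 1) = delta z := by
    ext k
    by_cases hk : k = z <;> simp [delta, hk]
  rw [hδ] at hl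
  refine ⟨hz, hst, l, ⟨hl, fun j hj => ?_⟩, fun j hj => by simp [hcount, hj]⟩
  have h1 : delta z + (fun j => (l.count j : ℤ)) = fun _ => 1 := by
    ext k
    by_cases hk : k = z <;> simp [delta, hk, hcount]
  have h2 : applySeq A (fun j => ρ j + lap A (delta z) j) l = ρ := by
    rw [applySeq_eq]
    change ρ + lap A (delta z) + _ = ρ
    rw [add_assoc, ← lap_add, h1, hA.lap_const, add_zero]
  rw [h2]
  exact hst j hj

end Burning

section Existence

/-- The minimum principle for the Laplacian with sink `z`. -/
theorem Eulerian.sink_le_of_lap_nonpos {A : V → V → ℕ} (hA : Eulerian A) (hC : Connected A)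
    {z : V} {w : V → ℤ} (hw : ∀ j, j ≠ z → lap A w j ≤ 0) (k : V) : w z ≤ w k := by
  have : Nonempty V := ⟨z⟩
  obtain ⟨x, hx⟩ := Finite.exists_min w
  refine le_trans ?_ (hx k)
  suffices h : w z = w x ∨ w z = w x from (or_self_iff.1 h).le
  refine Relation.ReflTransGen.head_induction_on (motive := fun a _ => w a = w x ∨ w z = w x)
    (hC z x) (Or.inl rfl) ?_
  intro a c hac _ ih
  rcases ih with hc | hc
  · by_cases hcz : c = z
    · exact Or.inr (hcz ▸ hc)
    · left
      have hle := hw c hcz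
      rw [hA.lap_eq_sum_sub] at hle
      have hnn : ∀ k ∈ Finset.univ, 0 ≤ (A k c : ℤ) * (w k - w c) := fun k _ =>
        mul_nonneg (by positivity) (by linarith [hx k])
      have h0 := (Finset.sum_eq_zero_iff_of_nonneg hnn).1
        (le_antisymm hle (Finset.sum_nonneg hnn)) a (Finset.mem_univ a)
      have : (A a c : ℤ) ≠ 0 := by exact_mod_cast hac.ne'
      have := (mul_eq_zero.1 h0).resolve_left this
      linarith
  · exact Or.inr hc

theorem Eulerian.exists_lap_le_neg_one {A : V → V → ℕ} (hA : Eulerian A) (hC : Connected A)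
    (z : V) : ∃ g : V → ℤ, g z = 0 ∧ ∀ j, j ≠ z → lap A g j ≤ -1 := by
  let M : Matrix V V ℤ := Matrix.of fun j k =>
    if j = z then delta z k else lap A (delta k) j
  have hlap : ∀ (u : V → ℤ) (j : V), ∑ k, lap A (delta k) j * u k = lap A u j := by
    intro u j
    have hu : u = ∑ k, u k • delta k := by
      ext x; simp [delta]
    conv_rhs => rw [hu, ← lapHom_apply, map_sum, Finset.sum_apply]
    refine Finset.sum_congr rfl fun k _ => ?_
    rw [map_zsmul, lapHom_apply]
    simp [mul_comm]
  have hMz : ∀ u : V → ℤ, M.mulVec u z = u z := by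
    intro u; simp [M, Matrix.mulVec, dotProduct, delta]
  have hM : ∀ (u : V → ℤ) (j : V), j ≠ z → M.mulVec u j = lap A u j := by
    intro u j hj
    rw [← hlap]
    simp [M, Matrix.mulVec, dotProduct, hj]
  have hdet : M.det ≠ 0 := by
    intro h
    obtain ⟨u, hu0, hu⟩ := Matrix.exists_mulVec_eq_zero_iff.2 h
    apply hu0
    have hz : u z = 0 := (hMz u).symm.trans (by rw [hu]; rfl)
    have hj : ∀ j, j ≠ z → lap A u j = 0 := fun j hj => by rw [← hM u j hj, hu]; rfl
    ext k
    have h1 := hA.sink_le_of_lap_nonpos hC (w := u) (z := z) (fun j h => (hj j h).le) k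
    have h2 := hA.sink_le_of_lap_nonpos hC (w := -u) (z := z)
      (fun j h => by simp [lap_neg, hj j h]) k
    simp only [Pi.neg_apply, hz, neg_zero] at h1 h2
    simp only [Pi.zero_apply]
    linarith
  let b : V → ℤ := fun j => if j = z then 0 else -M.det
  refine ⟨M.adjugate.mulVec b, ?_, fun j hj => ?_⟩
  · rw [← hMz (M.adjugate.mulVec b), Matrix.mulVec_mulVec, Matrix.mul_adjugate]
    simp [b]
  · rw [← hM _ j hj, Matrix.mulVec_mulVec, Matrix.mul_adjugate]
    simp only [Matrix.smul_mulVec, Matrix.one_mulVec, Pi.smul_apply, b, hj, if_false, smul_eq_mul]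
    have : 0 < M.det * M.det := mul_self_pos.2 hdet
    linarith

/-- Every sandpile is equivalent to a recurrent one, up to chips at the sink. -/
theorem Eulerian.exists_zRec {A : V → V → ℕ} (hA : Eulerian A) (hC : Connected A)
    (z : V) (s : V → ℤ) : ∃ ρ, ZRec A z ρ ∧ ∃ (m : ℤ) (v : V → ℤ),
      s = ρ + m • delta z + lap A v := by
  obtain ⟨g, hgz, hg⟩ := hA.exists_lap_le_neg_one hC z
  have hg0 : 0 ≤ g := fun k => by
    have := hA.sink_le_of_lap_nonpos hC (w := g) (z := z) (fun j h => by linarith [hg j h]) k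
    rwa [hgz] at this
  let P : (V → ℤ) → Prop := fun v => v z = 0 ∧ ∀ j, j ≠ z → s j + lap A v j ≤ (deg A j : ℤ) - 1
  obtain ⟨C, hC0, hCs⟩ : ∃ C : ℤ, 0 ≤ C ∧ ∀ j, |s j - ((deg A j : ℤ) - 1)| ≤ C :=
    ⟨∑ j, |s j - ((deg A j : ℤ) - 1)|, Finset.sum_nonneg fun _ _ => abs_nonneg _, fun j =>
      Finset.single_le_sum (f := fun j => |s j - ((deg A j : ℤ) - 1)|)
        (fun _ _ => abs_nonneg _) (Finset.mem_univ j)⟩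
  have hex : P (C • g) := by
    refine ⟨by simp [hgz], fun j hj => ?_⟩
    have h1 := (abs_le.1 (hCs j)).2
    have h2 : C * lap A g j ≤ C * (-1) := mul_le_mul_of_nonneg_left (hg j hj) hC0
    simp only [lap_zsmul, Pi.smul_apply, smul_eq_mul]
    linarith
  have hbdd : ∀ v, P v → ∀ k, -(C * g k) ≤ v k := by
    intro v hv k
    have := hA.sink_le_of_lap_nonpos hC (w := v + C • g) (z := z) (fun j hj => by
      have h0 := hv.2 j hj
      have h1 := (abs_le.1 (hCs j)).1
      have h2 : C * lap A g j ≤ C * (-1) := mul_le_mul_of_nonneg_left (hg j hj) hC0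
      simp only [lap_add, lap_zsmul, Pi.add_apply, Pi.smul_apply, smul_eq_mul]
      linarith) k
    simp only [Pi.add_apply, Pi.smul_apply, smul_eq_mul, hv.1, hgz] at this
    linarith
  obtain ⟨n, ⟨v, hv, rfl⟩, hmin⟩ := Int.exists_least_of_bdd
    (P := fun n => ∃ v, P v ∧ totalMass v = n)
    ⟨totalMass fun k => -(C * g k), by
      rintro n ⟨v, hv, rfl⟩
      exact Finset.sum_le_sum fun k _ => hbdd v hv k⟩
    ⟨_, _, hex, rfl⟩
  let m : ℤ := s z + lap A v z - deg A z
  refine ⟨s + lap A v - m • delta z, zRec_of_burnable hA ?_ ?_ ?_, m, -v, ?_⟩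
  · simp [m, delta]
  · intro j hj
    simpa [delta, hj] using hv.2 j hj
  · intro T hT hzT
    by_contra! hcon
    let χ : V → ℤ := fun k => if k ∈ T then 1 else 0
    have hχ : P (v - χ) := by
      refine ⟨by simp [χ, hzT, hv.1], fun j hj => ?_⟩
      have hsplit : -χ = (fun k => (if k ∈ T then (0 : ℤ) else 1) - 1) := by
        ext k; by_cases hk : k ∈ T <;> simp [χ, hk]
      by_cases hjT : j ∈ T
      · have h1 := hcon j hjT
        simp only [Pi.sub_apply, Pi.add_apply, Pi.smul_apply, delta, hj, if_false, smul_zero,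
          sub_zero] at h1
        rw [sub_eq_add_neg, lap_add, hsplit, hA.lap_sub_const, Pi.add_apply,
          lap_indicator_compl A hjT]
        linarith
      · have h1 := hv.2 j hj
        have h2 := lap_nonneg_of_eq_zero A (u := χ) (j := j)
          (fun k => by by_cases hk : k ∈ T <;> simp [χ, hk]) (by simp [χ, hjT])
        rw [lap_sub, Pi.sub_apply]
        linarith
    have h1 := hmin _ ⟨_, hχ, rfl⟩
    have h2 : totalMass (v - χ) = totalMass v - T.card := by
      simp [totalMass, χ, Finset.sum_sub_distrib]
    have h3 := Finset.card_pos.2 hT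
    omega
  · rw [lap_neg]; abel

end Existence

section RandomWalk

variable {K : Type*} [AddCommGroup K]

/-- One step of the random walk with increments `e j` taken with weights `α j`. -/
def walkStep (α : V → ℝ) (e : V → K) (f : K → ℝ) (x : K) : ℝ := ∑ j, α j * f (x - e j)

/-- The unit mass at the origin. -/
def originMass (x : K) : ℝ := if x = 0 then 1 else 0

theorem walkStep_mono {α : V → ℝ} (hα : ∀ j, 0 < α j) (e : V → K) : Monotone (walkStep α e) :=
  fun _ _ h x => Finset.sum_le_sum fun j _ => mul_le_mul_of_nonneg_left (h (x - e j)) (hα j).le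

theorem walkStep_iterate_sub_const {α : V → ℝ} (hα : ∑ j, α j = 1) (e : V → K) (n : ℕ)
    (f : K → ℝ) (c : ℝ) :
    (walkStep α e)^[n] (fun x => f x - c) = fun x => (walkStep α e)^[n] f x - c := by
  induction n generalizing f with
  | zero => rfl
  | succ n ih =>
    rw [Function.iterate_succ_apply, Function.iterate_succ_apply, ← ih]
    congr 1
    ext x
    simp [walkStep, mul_sub, Finset.sum_sub_distrib, ← Finset.sum_mul, hα]

theorem walkStep_iterate_const {α : V → ℝ} (hα : ∑ j, α j = 1) (e : V → K) (n : ℕ) (c : ℝ) :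
    (walkStep α e)^[n] (fun _ => c) = fun _ => c := by
  refine Function.iterate_fixed ?_ n
  ext x
  simp [walkStep, ← Finset.sum_mul, hα]

theorem sum_walkStep_iterate [Fintype K] {α : V → ℝ} (hα : ∑ j, α j = 1) (e : V → K) (n : ℕ)
    (f : K → ℝ) : ∑ x, (walkStep α e)^[n] f x = ∑ x, f x := by
  induction n generalizing f with
  | zero => rfl
  | succ n ih =>
    rw [Function.iterate_succ_apply, ih]
    simp only [walkStep]
    rw [Finset.sum_comm]
    have : ∀ j, ∑ x, α j * f (x - e j) = α j * ∑ x, f x := fun j => by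
      rw [← Finset.mul_sum]
      exact congrArg _ ((Equiv.subRight (e j)).sum_comp f)
    simp only [this, ← Finset.sum_mul, hα, one_mul]

theorem walkStep_iterate_le {α : V → ℝ} (hα : ∀ j, 0 < α j) (hα1 : ∑ j, α j = 1) (e : V → K)
    (n : ℕ) {f : K → ℝ} {c : ℝ} (hf : ∀ x, f x ≤ c) (x : K) : (walkStep α e)^[n] f x ≤ c := by
  have := (walkStep_mono hα e).iterate n (show f ≤ fun _ => c from hf) x
  rwa [walkStep_iterate_const hα1] at this

theorem le_walkStep_iterate {α : V → ℝ} (hα : ∀ j, 0 < α j) (hα1 : ∑ j, α j = 1) (e : V → K)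
    (n : ℕ) {f : K → ℝ} {c : ℝ} (hf : ∀ x, c ≤ f x) (x : K) : c ≤ (walkStep α e)^[n] f x := by
  have := (walkStep_mono hα e).iterate n (show (fun _ => c) ≤ f from hf) x
  rwa [walkStep_iterate_const hα1] at this

theorem walkStep_reach {α : V → ℝ} (hα : ∀ j, 0 < α j) {e : V → K} {i : V} (hi : e i = 0)
    {y : K} (hy : y ∈ AddSubmonoid.closure (Set.range e)) :
    ∀ᶠ n in atTop, ∃ c : ℝ, 0 < c ∧ ∀ f : K → ℝ, 0 ≤ f → ∀ x,
      c * f (x - y) ≤ (walkStep α e)^[n] f x := by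
  have hterm : ∀ (f : K → ℝ), 0 ≤ f → ∀ x j, α j * f (x - e j) ≤ walkStep α e f x :=
    fun f hf x j => Finset.single_le_sum (f := fun j => α j * f (x - e j))
      (fun k _ => mul_nonneg (hα k).le (hf _)) (Finset.mem_univ j)
  have hpos : ∀ (f : K → ℝ), 0 ≤ f → 0 ≤ walkStep α e f := fun f hf x =>
    Finset.sum_nonneg fun k _ => mul_nonneg (hα k).le (hf _)
  have hext : ∀ (z : K) (j : V) (n : ℕ), (∃ c : ℝ, 0 < c ∧ ∀ f : K → ℝ, 0 ≤ f → ∀ x,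
      c * f (x - z) ≤ (walkStep α e)^[n] f x) → ∃ c : ℝ, 0 < c ∧ ∀ f : K → ℝ, 0 ≤ f → ∀ x,
      c * f (x - (e j + z)) ≤ (walkStep α e)^[n + 1] f x := by
    rintro z j n ⟨c, hc, h⟩
    refine ⟨c * α j, mul_pos hc (hα j), fun f hf x => ?_⟩
    rw [Function.iterate_succ_apply]
    refine le_trans ?_ (h _ (hpos f hf) x)
    rw [mul_assoc]
    refine mul_le_mul_of_nonneg_left ?_ hc.le
    rw [show x - (e j + z) = x - z - e j by abel]
    exact hterm f hf _ j
  suffices h : ∃ n, ∃ c : ℝ, 0 < c ∧ ∀ f : K → ℝ, 0 ≤ f → ∀ x,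
      c * f (x - y) ≤ (walkStep α e)^[n] f x by
    obtain ⟨n, hn⟩ := h
    refine eventually_atTop.2 ⟨n, fun m hm => ?_⟩
    induction m, hm using Nat.le_induction with
    | base => exact hn
    | succ m _ ih => simpa [hi] using hext y i m ih
  induction hy using AddSubmonoid.closure_induction_left with
  | zero => exact ⟨0, 1, one_pos, fun f _ x => by simp⟩
  | add_left a ha z _ ih =>
    obtain ⟨j, rfl⟩ := ha
    obtain ⟨n, hn⟩ := ih
    exact ⟨n + 1, hext z j n hn⟩

/-- Doeblin minorization for a lazy random walk on a finite group. -/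
theorem exists_walkStep_minorization [Finite K] {α : V → ℝ} (hα : ∀ j, 0 < α j) {e : V → K}
    {i : V} (hi : e i = 0) (hgen : AddSubmonoid.closure (Set.range e) = ⊤) :
    ∃ (n : ℕ) (c : ℝ), 0 < c ∧ c < 1 ∧ ∀ f : K → ℝ, 0 ≤ f → ∀ x y,
      c * f y ≤ (walkStep α e)^[n] f x := by
  obtain ⟨n, hn⟩ := (eventually_all.2 fun y : K =>
    walkStep_reach hα hi (hgen ▸ AddSubmonoid.mem_top y)).exists
  choose c hc h using hn
  obtain ⟨y₀, hy₀⟩ := Finite.exists_min c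
  refine ⟨n, min (c y₀) (1 / 2), lt_min (hc y₀) (by norm_num),
    lt_of_le_of_lt (min_le_right _ _) (by norm_num), fun f hf x y => ?_⟩
  have h1 := h (x - y) f hf x
  rw [sub_sub_cancel] at h1
  exact (mul_le_mul_of_nonneg_right ((min_le_left _ _).trans (hy₀ _)) (hf y)).trans h1

theorem exists_walkStep_osc_le [Finite K] {α : V → ℝ} (hα : ∀ j, 0 < α j)
    (hα1 : ∑ j, α j = 1) {e : V → K} {i : V} (hi : e i = 0)
    (hgen : AddSubmonoid.closure (Set.range e) = ⊤) :
    ∃ (n : ℕ) (c : ℝ), 0 < c ∧ c < 1 ∧ ∀ (f : K → ℝ) (D : ℝ), (∀ x y, f x - f y ≤ D) →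
      ∀ x y, (walkStep α e)^[n] f x - (walkStep α e)^[n] f y ≤ (1 - c) * D := by
  obtain ⟨n, c, hc, hc1, h⟩ := exists_walkStep_minorization hα hi hgen
  refine ⟨n, c, hc, hc1, fun f D hD x y => ?_⟩
  obtain ⟨a, ha⟩ := Finite.exists_min f
  obtain ⟨b, hb⟩ := Finite.exists_max f
  have h1 := walkStep_iterate_le hα hα1 e n hb x
  have h2 := h (fun x => f x - f a) (fun x => sub_nonneg.2 (ha x)) y b
  rw [walkStep_iterate_sub_const hα1] at h2
  have h3 : (1 - c) * (f b - f a) ≤ (1 - c) * D :=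
    mul_le_mul_of_nonneg_left (hD b a) (by linarith)
  linarith

/-- A lazy random walk on a finite group whose increments generate the group equidistributes. -/
theorem walkStep_equidistribution [Fintype K] {α : V → ℝ} (hα : ∀ j, 0 < α j)
    (hα1 : ∑ j, α j = 1) {e : V → K} {i : V} (hi : e i = 0)
    (hgen : AddSubmonoid.closure (Set.range e) = ⊤) {ε : ℝ} (hε : 0 < ε) :
    ∃ N : ℕ, ∀ n, N ≤ n → ∀ x : K,
      |(walkStep α e)^[n] originMass x - 1 / Nat.card K| ≤ ε := by
  obtain ⟨n₀, c, hc, hc1, h⟩ := exists_walkStep_osc_le hα hα1 hi hgen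
  have hosc : ∀ k : ℕ, ∀ x y,
      (walkStep α e)^[n₀ * k] originMass x - (walkStep α e)^[n₀ * k] originMass y
        ≤ (1 - c) ^ k := by
    intro k
    induction k with
    | zero =>
      intro x y
      simp only [originMass, mul_zero, Function.iterate_zero, id, pow_zero]
      split_ifs <;> norm_num
    | succ k ih =>
      intro x y
      rw [Nat.mul_succ, Nat.add_comm, Function.iterate_add_apply, pow_succ']
      exact h _ _ ih x y
  obtain ⟨k, hk⟩ := exists_pow_lt_of_lt_one hε (show 1 - c < 1 by linarith)
  refine ⟨n₀ * k, fun n hn x => ?_⟩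
  obtain ⟨m, rfl⟩ := Nat.exists_eq_add_of_le' hn
  have hsum := sum_walkStep_iterate hα1 e (m + n₀ * k) originMass
  rw [Function.iterate_add_apply] at hsum ⊢
  set f := (walkStep α e)^[n₀ * k] originMass
  set g := (walkStep α e)^[m] f with hg
  have hosc' : ∀ x y, g x - g y ≤ ε := by
    intro x y
    obtain ⟨a, ha⟩ := Finite.exists_min f
    obtain ⟨b, hb⟩ := Finite.exists_max f
    have h1 := walkStep_iterate_le hα hα1 e m hb x
    have h2 := le_walkStep_iterate hα hα1 e m ha y
    have h3 := hosc k b a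
    linarith
  have hcard : (0 : ℝ) < Nat.card K := by exact_mod_cast Nat.card_pos
  have hmean : ∑ y, (g x - g y) = Nat.card K * (g x - 1 / Nat.card K) := by
    rw [Finset.sum_sub_distrib, hsum, mul_sub, mul_one_div_cancel hcard.ne']
    simp [originMass]
  have hmean' : ∑ y, (g x - g y) ≤ Nat.card K * ε := by
    have := Finset.sum_le_sum fun y (_ : y ∈ Finset.univ) => hosc' x y
    simpa using this
  have hmean'' : Nat.card K * (-ε) ≤ ∑ y, (g x - g y) := by
    have := Finset.sum_le_sum fun y (_ : y ∈ Finset.univ) =>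
      (show -ε ≤ g x - g y by linarith [hosc' y x])
    simpa using this
  rw [hmean] at hmean' hmean''
  exact abs_le.2 ⟨le_of_mul_le_mul_left hmean'' hcard, le_of_mul_le_mul_left hmean' hcard⟩

/-- The words of length `n` on the alphabet `V`. -/
def words (V : Type*) [Fintype V] [DecidableEq V] : ℕ → Finset (List V)
  | 0 => {[]}
  | n + 1 => (Finset.univ ×ˢ words V n).image fun p => p.1 :: p.2

theorem mem_words {n : ℕ} {w : List V} : w ∈ words V n ↔ w.length = n := by
  induction n generalizing w with
  | zero => simp [words]
  | succ n ih => cases w <;> simp [words, ih]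

theorem sum_words_succ (n : ℕ) (f : List V → ℝ) :
    ∑ w ∈ words V (n + 1), f w = ∑ j, ∑ w ∈ words V n, f (j :: w) := by
  rw [words, Finset.sum_image, Finset.sum_product]
  rintro ⟨a, l⟩ - ⟨b, l'⟩ - h
  simpa using h

theorem sum_words_eq_walkStep (α : V → ℝ) (e : V → K) (n : ℕ) (x : K) :
    ∑ w ∈ words V n, (if (w.map e).sum = x then wordProb α w else 0) =
      (walkStep α e)^[n] originMass x := by
  induction n generalizing x with
  | zero => simp [words, wordProb, originMass, eq_comm]
  | succ n ih =>
    rw [sum_words_succ, Function.iterate_succ_apply', walkStep]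
    refine Finset.sum_congr rfl fun j _ => ?_
    rw [← ih, Finset.mul_sum]
    refine Finset.sum_congr rfl fun w _ => ?_
    simp only [List.map_cons, List.sum_cons, wordProb, List.prod_cons, mul_ite, mul_zero,
      eq_sub_iff_add_eq']

end RandomWalk

section SandpileGroup

/-- The subgroup generated by the image of the Laplacian and a chip at the sink. -/
def sinkLattice (A : V → V → ℕ) (z : V) : AddSubgroup (V → ℤ) :=
  (lapHom A).range ⊔ AddSubgroup.zmultiples (delta z)

theorem mem_sinkLattice {A : V → V → ℕ} {z : V} {s : V → ℤ} :
    s ∈ sinkLattice A z ↔ ∃ (m : ℤ) (v : V → ℤ), s = m • delta z + lap A v := by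
  rw [sinkLattice, AddSubgroup.mem_sup]
  constructor
  · rintro ⟨_, ⟨v, rfl⟩, _, ⟨m, rfl⟩, rfl⟩
    exact ⟨m, v, add_comm _ _⟩
  · rintro ⟨m, v, rfl⟩
    exact ⟨_, ⟨v, rfl⟩, _, ⟨m, rfl⟩, add_comm _ _⟩

/-- The sandpile group with sink `z`. -/
abbrev SandpileGroup (A : V → V → ℕ) (z : V) : Type _ := (V → ℤ) ⧸ sinkLattice A z

theorem sandpileGroup_mk_eq_iff {A : V → V → ℕ} {z : V} {s t : V → ℤ} :
    (s : SandpileGroup A z) = t ↔ ∃ (m : ℤ) (v : V → ℤ), t = s + m • delta z + lap A v := by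
  rw [QuotientAddGroup.eq, mem_sinkLattice]
  simp only [neg_add_eq_iff_eq_add, add_assoc]

theorem bijective_zRec_sandpileGroup {A : V → V → ℕ} (hA : Eulerian A) (hC : Connected A)
    (z : V) : Function.Bijective
      fun ρ : {ρ : V → ℤ // ZRec A z ρ} => (ρ.1 : SandpileGroup A z) := by
  constructor
  · rintro ⟨ρ, hρ⟩ ⟨ρ', hρ'⟩ h
    obtain ⟨m, v, h⟩ := sandpileGroup_mk_eq_iff.1 h
    exact Subtype.ext (hρ.unique hA hρ' h).symm
  · intro x
    obtain ⟨s, rfl⟩ := QuotientAddGroup.mk_surjective x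
    obtain ⟨ρ, hρ, m, v, h⟩ := hA.exists_zRec hC z s
    exact ⟨⟨ρ, hρ⟩, sandpileGroup_mk_eq_iff.2 ⟨m, v, h⟩⟩

theorem mk_delta_self (A : V → V → ℕ) (z : V) : (delta z : SandpileGroup A z) = 0 :=
  (QuotientAddGroup.eq_zero_iff _).2 (mem_sinkLattice.2 ⟨1, 0, by simp [lap_zero]⟩)

theorem closure_mk_delta (A : V → V → ℕ) (z : V) [Finite (SandpileGroup A z)] :
    AddSubmonoid.closure (Set.range fun j : V => (delta j : SandpileGroup A z)) = ⊤ := by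
  rw [← AddSubgroup.closure_toAddSubmonoid_of_finite, eq_top_iff]
  rintro x -
  obtain ⟨s, rfl⟩ := QuotientAddGroup.mk_surjective x
  have hs : s = ∑ k, s k • delta k := by ext x; simp [delta]
  rw [hs]
  change ((QuotientAddGroup.mk' _ (∑ k, s k • delta k)) : SandpileGroup A z) ∈ _
  rw [map_sum]
  refine AddSubgroup.sum_mem _ fun k _ => ?_
  rw [map_zsmul]
  exact AddSubgroup.zsmul_mem _ (AddSubgroup.subset_closure (Set.mem_range_self k)) _

end SandpileGroup

section Chain

theorem closedAdd_eq (A : V → V → ℕ) (i : V) (s : V → ℤ) :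
    ∃ u, closedAdd A i s = s + delta i + lap A u := by
  unfold closedAdd
  split_ifs
  · exact ⟨_, applySeq_eq A _ _⟩
  · exact ⟨0, by rw [lap_zero, add_zero]; rfl⟩

theorem chain_eq (A : V → V → ℕ) (s : V → ℤ) (w : List V) :
    ∃ u, chain A s w = s + (w.map delta).sum + lap A u := by
  induction w generalizing s with
  | nil => exact ⟨0, by simp [chain, lap_zero]⟩
  | cons i w ih =>
    obtain ⟨u, hu⟩ := closedAdd_eq A i s
    obtain ⟨u', hu'⟩ := ih (closedAdd A i s)
    refine ⟨u + u', ?_⟩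
    change chain A (closedAdd A i s) w = _
    rw [hu', hu, lap_add, List.map_cons, List.sum_cons]
    abel

theorem Eulerian.stabilizable_chain_iff {A : V → V → ℕ} (hA : Eulerian A) (s : V → ℤ)
    (w : List V) : Stabilizable A (chain A s w) ↔ Stabilizable A (s + (w.map delta).sum) := by
  obtain ⟨u, hu⟩ := chain_eq A s w
  rw [hu, hA.stabilizable_add_lap]

theorem sum_delta_nonneg (w : List V) : 0 ≤ (w.map delta).sum := by
  refine List.sum_nonneg fun x hx => ?_
  obtain ⟨j, -, rfl⟩ := List.mem_map.1 hx
  intro k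
  simp only [delta, Pi.zero_apply]
  split_ifs <;> norm_num

theorem totalMass_sum_delta (w : List V) : totalMass (w.map delta).sum = w.length := by
  induction w with
  | nil => simp [totalMass]
  | cons j w ih =>
    rw [List.map_cons, List.sum_cons, totalMass_add, ih, totalMass_delta, List.length_cons]
    push_cast; ring

theorem mk_sum_delta (A : V → V → ℕ) (z : V) (w : List V) :
    (((w.map delta).sum : V → ℤ) : SandpileGroup A z) =
      (w.map fun j => (delta j : SandpileGroup A z)).sum := by
  change QuotientAddGroup.mk' (sinkLattice A z) _ = _
  rw [map_list_sum, List.map_map]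
  rfl

theorem ZRec.rz_eq_iff {A : V → V → ℕ} (hA : Eulerian A) {z : V} {ρ : V → ℤ} (hρ : ZRec A z ρ)
    (s : V → ℤ) : Rz A z s = ρ ↔ ∃ (m : ℤ) (v : V → ℤ), s = ρ + m • delta z + lap A v := by
  unfold Rz
  split_ifs with h
  · obtain ⟨m, v, hrec, -, hdec⟩ := h.choose_spec
    generalize h.choose = ρ' at *
    have hdec' : s = ρ' + m • delta z + lap A v := by
      ext j; simpa using hdec j
    constructor
    · rintro rfl
      exact ⟨m, v, hdec'⟩
    · rintro ⟨m', v', h'⟩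
      refine hρ.unique hA hrec (m := m' - m) (v := v' - v) ?_
      rw [lap_sub, sub_smul, eq_comm, ← sub_eq_zero]
      rw [h', ← sub_eq_zero] at hdec'
      rw [← hdec']
      abel
  · have hno : ¬ ∃ (m : ℤ) (v : V → ℤ), s = ρ + m • delta z + lap A v := by
      rintro ⟨m, v, h'⟩
      refine h ⟨ρ, m, fun k => v k - v z, hρ, by simp, fun j => ?_⟩
      rw [hA.lap_sub_const, h']
      simp
    refine iff_of_false (fun e => hno ⟨0, 0, ?_⟩) hno
    rw [e, lap_zero]; simp

/-- The threshold is reached by adding a chip at the sink, leaving the recurrent class `ρ`,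
exactly when the class of the sandpile just before is that of `ρ - δ_z`. -/
theorem ZRec.threshold_iff {A : V → V → ℕ} (hA : Eulerian A) {z : V} {ρ : V → ℤ}
    (hρ : ZRec A z ρ) (s : V → ℤ) (w : List V) :
    (IsThresholdWord A s (w ++ [z]) ∧ Rz A z (chain A s (w ++ [z])) = ρ) ↔
      (w.length : ℤ) = totalMass ρ - 1 - totalMass s ∧
        (w.map fun j => (delta j : SandpileGroup A z)).sum =
          (ρ : SandpileGroup A z) - (s : SandpileGroup A z) := by
  have hcls : ((w.map fun j => (delta j : SandpileGroup A z)).sum =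
      (ρ : SandpileGroup A z) - (s : SandpileGroup A z)) ↔
      ∃ (m : ℤ) (v : V → ℤ), s + (w.map delta).sum = ρ + m • delta z + lap A v := by
    rw [← sandpileGroup_mk_eq_iff, ← mk_sum_delta, eq_sub_iff_add_eq', eq_comm,
      QuotientAddGroup.mk_add]
  have hmass : ∀ (m : ℤ) (v : V → ℤ), s + (w.map delta).sum = ρ + m • delta z + lap A v →
      totalMass s + w.length = totalMass ρ + m := by
    intro m v h
    have := congrArg totalMass h
    simpa only [totalMass_add, totalMass_sum_delta, totalMass_zsmul, totalMass_delta,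
      totalMass_lap, mul_one, add_zero] using this
  rw [hcls, hρ.rz_eq_iff hA]
  constructor
  · rintro ⟨⟨hns, hpre⟩, m, v, hm⟩
    have h1 := hpre w (List.prefix_append _ _) (by simp)
    rw [hm, hA.stabilizable_add_lap, hρ.stabilizable_add_zsmul_iff hA] at hns
    obtain ⟨u, hu⟩ := chain_eq A s (w ++ [z])
    have hw : s + (w.map delta).sum = ρ + (m - 1) • delta z + lap A (v - u) := by
      have h2 := hu.symm.trans hm
      simp only [List.map_append, List.map_cons, List.map_nil, List.sum_append, List.sum_cons,
        List.sum_nil, add_zero] at h2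
      rw [lap_sub, sub_smul, one_smul, ← sub_eq_zero]
      rw [← sub_eq_zero] at h2
      rw [← h2]
      abel
    rw [hA.stabilizable_chain_iff, hw, hA.stabilizable_add_lap,
      hρ.stabilizable_add_zsmul_iff hA] at h1
    have := hmass _ _ hw
    exact ⟨by omega, _, _, hw⟩
  · rintro ⟨hlen, m, v, hw⟩
    obtain rfl : m = -1 := by have := hmass _ _ hw; omega
    have hfull : s + ((w ++ [z]).map delta).sum = ρ + lap A v := by
      simp only [List.map_append, List.map_cons, List.map_nil, List.sum_append, List.sum_cons,
        List.sum_nil, add_zero]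
      rw [← add_assoc, hw]
      simp only [neg_smul, one_smul]
      abel
    refine ⟨⟨?_, fun w' hw' hne => ?_⟩, ?_⟩
    · rw [hA.stabilizable_chain_iff, hfull, hA.stabilizable_add_lap]
      exact hρ.not_stabilizable hA
    · obtain ⟨r, rfl⟩ : w' <+: w := (List.prefix_concat_iff.1 hw').resolve_left hne
      rw [hA.stabilizable_chain_iff]
      refine hA.stabilizable_mono (t := s + ((w' ++ r).map delta).sum) ?_ ?_
      · rw [List.map_append, List.sum_append, ← add_assoc]
        exact le_add_of_nonneg_right (sum_delta_nonneg r)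
      · rw [hw, hA.stabilizable_add_lap, hρ.stabilizable_add_zsmul_iff hA]
        norm_num
    · obtain ⟨u, hu⟩ := chain_eq A s (w ++ [z])
      refine ⟨0, v + u, ?_⟩
      rw [hu, hfull, lap_add, zero_smul]
      abel

theorem ZRec.thresholdProb_eq {A : V → V → ℕ} (hA : Eulerian A) {z : V} {ρ : V → ℤ}
    (hρ : ZRec A z ρ) (α : V → ℝ) (s : V → ℤ) (n : ℕ)
    (hn : (n : ℤ) = totalMass ρ - 1 - totalMass s) :
    thresholdProb A α s (fun w => w.getLast? = some z ∧ Rz A z (chain A s w) = ρ) =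
      α z * (walkStep α fun j => (delta j : SandpileGroup A z))^[n]
        originMass ((ρ : SandpileGroup A z) - (s : SandpileGroup A z)) := by
  rw [thresholdProb, tsum_eq_sum (s := (words V n).image (· ++ [z])), Finset.sum_image,
    ← sum_words_eq_walkStep, Finset.mul_sum]
  · refine Finset.sum_congr rfl fun w hw => ?_
    have h := hρ.threshold_iff hA s w
    rw [mem_words.1 hw] at h
    simp only [hn, true_and] at h
    simp only [List.getLast?_append, List.getLast?_singleton, Option.some_or, true_and, h,
      mul_ite, mul_zero]
    refine if_congr Iff.rfl ?_ rfl
    simp [wordProb, mul_comm]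
  · intro a _ b _ h
    exact List.append_cancel_right h
  · intro w hw
    refine if_neg fun ⟨hthr, hlast, hR⟩ => hw ?_
    obtain ⟨w', rfl⟩ := List.getLast?_eq_some_iff.1 hlast
    refine Finset.mem_image_of_mem _ (mem_words.2 ?_)
    have := ((hρ.threshold_iff hA s w').1 ⟨hthr, hR⟩).1
    omega

end Chain

end ThresholdState

open ThresholdState in
/-- With the sink placed at the epicenter: `P{i_τ = i, R_i(s_τ) = ρ} → α_i/κ`
as `|s₀| → -∞`. -/
theorem statement_1 {V : Type*} [Fintype V] [DecidableEq V]
    (A : V → V → ℕ) (hEul : Eulerian A) (hConn : Connected A)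
    (α : V → ℝ) (hαpos : ∀ j, 0 < α j) (hαsum : ∑ j, α j = 1)
    (i : V) (ρ : V → ℤ) (hρ : ZRec A i ρ) :
    ∀ ε : ℝ, 0 < ε → ∃ K : ℤ, K < 0 ∧ ∀ s0 : V → ℤ, totalMass s0 < K →
      |thresholdProb A α s0
          (fun w => w.getLast? = some i ∧ Rz A i (chain A s0 w) = ρ)
        - α i / (kappa A i : ℝ)| ≤ ε := by
  intro ε hε
  have hbij := bijective_zRec_sandpileGroup hEul hConn i
  have := finite_zRec hEul i
  have : Finite (SandpileGroup A i) := Finite.of_surjective _ hbij.2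
  have := Fintype.ofFinite (SandpileGroup A i)
  have hκ : kappa A i = Nat.card (SandpileGroup A i) := Nat.card_congr (Equiv.ofBijective _ hbij)
  obtain ⟨N, hN⟩ := walkStep_equidistribution hαpos hαsum
    (e := fun j => (delta j : SandpileGroup A i)) (mk_delta_self A i) (closure_mk_delta A i)
    (div_pos hε (hαpos i))
  refine ⟨min (-1) (totalMass ρ - 1 - N), by omega, fun s0 hs0 => ?_⟩
  obtain ⟨n, hn⟩ := Int.eq_ofNat_of_zero_le (show 0 ≤ totalMass ρ - 1 - totalMass s0 by omega)
  rw [hρ.thresholdProb_eq hEul α s0 n hn.symm, hκ, ← mul_one_div, ← mul_sub, abs_mul,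
    abs_of_pos (hαpos i)]
  have := hN n (by omega) ((ρ : SandpileGroup A i) - (s0 : SandpileGroup A i))
  rwa [le_div_iff₀' (hαpos i)] at this
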